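/- arXiv:1809.00512 — 5 statements merged into one kernel-verified Lean document; each statement's English description precedes it below -/
import Mathlib

section
/- For a TLOU pricing with booking fee K > 0, lower price π^L a nonincreasing right-continuous step function with finite breakpoint set C^L, and higher price π^H a nondecreasing right-continuous step function with finite breakpoint set C^H, the expected cost C attains its minimum over all capacities c ≥ 0 at a point of the finite set S = {0} ∪ C^L ∪ {x_ω : ω ∈ Ω}; that is, there exists s ∈ S such that C(s) ≤ C(c) for every c ≥ 0. -/
/-- For a TLOU pricing with booking fee `K > 0`, lower price `πL` a
nonincreasing right-continuous step function with finite breakpoint set `CL`, and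
higher price `πH` a nondecreasing right-continuous step function with finite
breakpoint set `CH`, the expected cost `C` attains its minimum over all
capacities `c ≥ 0` at a point of the finite set `S = {0} ∪ CL ∪ {x ω : ω ∈ Ω}`. -/
theorem tlou_optimum_in_candidate_set
    {Ω : Type*} [Fintype Ω]
    (x p : Ω → ℝ) (hx : ∀ ω, 0 ≤ x ω) (hp : ∀ ω, 0 < p ω)
    (K : ℝ) (hK : 0 < K)
    (πL πH : ℝ → ℝ) (CL CH : Finset ℝ)
    (hCLpos : ∀ s ∈ CL, 0 < s) (hCHpos : ∀ s ∈ CH, 0 < s)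
    (hπLanti : Antitone πL) (hπHmono : Monotone πH)
    -- right-continuous step function with breakpoints `CL`:
    -- constant on any interval containing no breakpoint in `(a, b]`
    (hπLstep : ∀ a b : ℝ, a ≤ b → (∀ s ∈ CL, ¬ (a < s ∧ s ≤ b)) → πL a = πL b)
    (hπHstep : ∀ a b : ℝ, a ≤ b → (∀ s ∈ CH, ¬ (a < s ∧ s ≤ b)) → πH a = πH b)
    (C : ℝ → ℝ)
    (hC : ∀ c : ℝ, C c = K * c
      + πL c * ∑ ω ∈ Finset.univ.filter (fun ω => x ω ≤ c), x ω * p ω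
      + πH c * ∑ ω ∈ Finset.univ.filter (fun ω => c < x ω), x ω * p ω) :
    ∃ s ∈ insert (0 : ℝ) (CL ∪ Finset.image x Finset.univ),
      ∀ c : ℝ, 0 ≤ c → C s ≤ C c := by
  have hround : ∀ c : ℝ, 0 ≤ c →
      ∃ s ∈ insert (0 : ℝ) (CL ∪ Finset.image x Finset.univ), C s ≤ C c := by
    intro c hc
    obtain ⟨s, hs, hsmax⟩ := Finset.exists_max_image
      ((insert (0 : ℝ) (CL ∪ Finset.image x Finset.univ)).filter (· ≤ c)) id
      ⟨0, Finset.mem_filter.2 ⟨Finset.mem_insert_self _ _, hc⟩⟩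
    obtain ⟨hsS, hsc⟩ := Finset.mem_filter.1 hs
    have hmax : ∀ t ∈ insert (0 : ℝ) (CL ∪ Finset.image x Finset.univ), t ≤ c → t ≤ s :=
      fun t ht htc => hsmax t (Finset.mem_filter.2 ⟨ht, htc⟩)
    have hxs : ∀ ω, x ω ≤ s ↔ x ω ≤ c := fun ω =>
      ⟨fun h => h.trans hsc, hmax _ (by simp)⟩
    have hL : πL s = πL c := hπLstep s c hsc fun t ht h =>
      h.1.not_ge (hmax t (by simp [ht]) h.2)
    have hnonneg : 0 ≤ ∑ ω ∈ Finset.univ.filter (fun ω => c < x ω), x ω * p ω :=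
      Finset.sum_nonneg fun ω _ => mul_nonneg (hx ω) (hp ω).le
    have hH := hπHmono hsc
    refine ⟨s, hsS, ?_⟩
    rw [hC s, hC c, hL]
    simp only [← not_le, hxs] at hnonneg ⊢
    gcongr
  obtain ⟨s, hs, hmin⟩ := Finset.exists_min_image
    (insert (0 : ℝ) (CL ∪ Finset.image x Finset.univ)) C ⟨0, Finset.mem_insert_self _ _⟩
  refine ⟨s, hs, fun c hc => ?_⟩
  obtain ⟨t, ht, htc⟩ := hround c hc
  exact (hmin t ht).trans htc
end

section
/- For a TLOU pricing with booking fee K > 0, lower price π^L a nonincreasing right-continuous step function with finite breakpoint set C^L, and higher price π^H a nondecreasing right-continuous step function with finite breakpoint set C^H, for every capacity c ≥ 0 there exists s ∈ S = {0} ∪ C^L ∪ {x_ω : ω ∈ Ω} with s ≤ c and C(s) ≤ C(c). -/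
/-- Among the elements of a finite set that are at most `c`, there is a largest one as soon as
there is any at all. -/
lemma Finset.exists_greatest_le {α : Type*} [LinearOrder α] (S : Finset α) {a c : α}
    (ha : a ∈ S) (hac : a ≤ c) : ∃ s ∈ S, s ≤ c ∧ ∀ t ∈ S, t ≤ c → t ≤ s := by
  obtain ⟨s, hs, hmax⟩ := (S.filter (· ≤ c)).exists_max_image id
    ⟨a, Finset.mem_filter.2 ⟨ha, hac⟩⟩
  rw [Finset.mem_filter] at hs
  exact ⟨s, hs.1, hs.2, fun t ht htc => hmax t (Finset.mem_filter.2 ⟨ht, htc⟩)⟩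

/-- For a TLOU pricing with booking fee `K > 0`, lower price `πL` a
nonincreasing right-continuous step function with finite breakpoint set `CL`, and
higher price `πH` a nondecreasing right-continuous step function with finite
breakpoint set `CH`, for every capacity `c ≥ 0` there exists
`s ∈ S = {0} ∪ CL ∪ {x ω : ω ∈ Ω}` with `s ≤ c` and `C s ≤ C c`. -/
theorem tlou_dominating_candidate_below
    {Ω : Type*} [Fintype Ω]
    (x p : Ω → ℝ) (hx : ∀ ω, 0 ≤ x ω) (hp : ∀ ω, 0 < p ω)
    (K : ℝ) (hK : 0 < K)
    (πL πH : ℝ → ℝ) (CL CH : Finset ℝ)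
    (hCLpos : ∀ s ∈ CL, 0 < s) (hCHpos : ∀ s ∈ CH, 0 < s)
    (hπLanti : Antitone πL) (hπHmono : Monotone πH)
    (hπLstep : ∀ a b : ℝ, a ≤ b → (∀ s ∈ CL, ¬ (a < s ∧ s ≤ b)) → πL a = πL b)
    (hπHstep : ∀ a b : ℝ, a ≤ b → (∀ s ∈ CH, ¬ (a < s ∧ s ≤ b)) → πH a = πH b)
    (C : ℝ → ℝ)
    (hC : ∀ c : ℝ, C c = K * c
      + πL c * ∑ ω ∈ Finset.univ.filter (fun ω => x ω ≤ c), x ω * p ω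
      + πH c * ∑ ω ∈ Finset.univ.filter (fun ω => c < x ω), x ω * p ω) :
    ∀ c : ℝ, 0 ≤ c →
      ∃ s ∈ insert (0 : ℝ) (CL ∪ Finset.image x Finset.univ),
        s ≤ c ∧ C s ≤ C c := by
  intro c hc
  obtain ⟨s, hsS, hsc, hmax⟩ :=
    (insert (0 : ℝ) (CL ∪ Finset.image x Finset.univ)).exists_greatest_le
      (Finset.mem_insert_self _ _) hc
  refine ⟨s, hsS, hsc, ?_⟩
  have hπL : πL s = πL c := hπLstep s c hsc fun t ht hst =>
    hst.1.not_ge (hmax t (by simp [ht]) hst.2)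
  have hle (ω : Ω) : x ω ≤ s ↔ x ω ≤ c :=
    ⟨fun h => h.trans hsc, hmax (x ω) (by simp)⟩
  have hlt (ω : Ω) : s < x ω ↔ c < x ω := by
    simpa only [not_le] using not_congr (hle ω)
  have hsum : 0 ≤ ∑ ω ∈ Finset.univ.filter (fun ω => c < x ω), x ω * p ω :=
    Finset.sum_nonneg fun ω _ => mul_nonneg (hx ω) (hp ω).le
  simp only [hC, hπL, hle, hlt]
  gcongr
  exact hπHmono hsc
end

section
/- Let c̄ > 0 and ε > 0 with ε ≤ c̄. If π^L is constant on [c̄ − ε, c̄ + ε], and no scenario consumption x_ω lies in (c̄ − ε, c̄ + ε], then C(c̄ + ε) − C(c̄ − ε) = 2εK + (π^H(c̄ + ε) − π^H(c̄ − ε)) · Σ_{ω : x_ω > c̄} x_ω p_ω. In particular, if K > 0 and π^H(c̄ + ε) ≥ π^H(c̄ − ε), then C(c̄ − ε) < C(c̄ + ε). -/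
/-- Let `c̄ > 0` and `ε > 0` with `ε ≤ c̄`. If `πL` is constant on
`[c̄ − ε, c̄ + ε]` and no scenario consumption `x ω` lies in `(c̄ − ε, c̄ + ε]`, then
`C (c̄ + ε) − C (c̄ − ε) = 2εK + (πH (c̄ + ε) − πH (c̄ − ε)) · Σ_{x ω > c̄} x ω p ω`.
In particular, if `K > 0` and `πH (c̄ + ε) ≥ πH (c̄ − ε)`, then
`C (c̄ − ε) < C (c̄ + ε)`. -/
theorem tlou_cost_jump_around_capacity
    {Ω : Type*} [Fintype Ω]
    (x p : Ω → ℝ) (hx : ∀ ω, 0 ≤ x ω) (hp : ∀ ω, 0 < p ω)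
    (K : ℝ) (πL πH : ℝ → ℝ)
    (C : ℝ → ℝ)
    (hC : ∀ c : ℝ, C c = K * c
      + πL c * ∑ ω ∈ Finset.univ.filter (fun ω => x ω ≤ c), x ω * p ω
      + πH c * ∑ ω ∈ Finset.univ.filter (fun ω => c < x ω), x ω * p ω)
    (cbar ε : ℝ) (hcbar : 0 < cbar) (hε : 0 < ε) (hεc : ε ≤ cbar)
    (hπLconst : ∀ c : ℝ, cbar - ε ≤ c → c ≤ cbar + ε → πL c = πL (cbar - ε))
    (hno : ∀ ω, ¬ (cbar - ε < x ω ∧ x ω ≤ cbar + ε)) :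
    C (cbar + ε) - C (cbar - ε)
      = 2 * ε * K + (πH (cbar + ε) - πH (cbar - ε))
          * ∑ ω ∈ Finset.univ.filter (fun ω => cbar < x ω), x ω * p ω
    ∧ (0 < K → πH (cbar - ε) ≤ πH (cbar + ε) →
        C (cbar - ε) < C (cbar + ε)) := by
  have low : ∀ c, cbar - ε ≤ c → c ≤ cbar + ε → ∀ ω, x ω ≤ c ↔ x ω ≤ cbar - ε := by
    intro c h₁ h₂ ω
    refine ⟨fun h => ?_, fun h => h.trans h₁⟩
    by_contra! h'
    exact hno ω ⟨h', h.trans h₂⟩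
  have high : ∀ c, cbar - ε ≤ c → c ≤ cbar + ε → ∀ ω, c < x ω ↔ cbar - ε < x ω := by
    intro c h₁ h₂ ω
    simpa only [not_le] using not_congr (low c h₁ h₂ ω)
  have jump : C (cbar + ε) - C (cbar - ε)
      = 2 * ε * K + (πH (cbar + ε) - πH (cbar - ε))
          * ∑ ω ∈ Finset.univ.filter (fun ω => cbar < x ω), x ω * p ω := by
    rw [hC, hC, hπLconst (cbar + ε) (by linarith) le_rfl]
    simp only [low (cbar + ε) (by linarith) le_rfl, high (cbar + ε) (by linarith) le_rfl,
      high cbar (by linarith) (by linarith)]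
    ring
  refine ⟨jump, fun hK hπH => ?_⟩
  have hsum : 0 ≤ ∑ ω ∈ Finset.univ.filter (fun ω => cbar < x ω), x ω * p ω :=
    Finset.sum_nonneg fun ω _ => mul_nonneg (hx ω) (hp ω).le
  have hfee : 0 < 2 * ε * K := by positivity
  have hover := mul_nonneg (sub_nonneg.mpr hπH) hsum
  linarith
end

section
/- Let K > 0 and let π^H be nondecreasing. Let c̄ > 0 and ε ∈ (0, c̄] be such that π^L is constant on [c̄ − ε, c̄] and no scenario consumption x_ω lies in (c̄ − ε, c̄]. Then C(c̄ − ε) < C(c̄); consequently, a capacity c̄ satisfying these conditions (in particular, a breakpoint of the higher price curve π^H that is not in {0} ∪ C^L ∪ {x_ω : ω ∈ Ω}) is never an optimal booked capacity for the user. -/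
/-- Let `K > 0` and let `πH` be nondecreasing. Let `c̄ > 0` and
`ε ∈ (0, c̄]` be such that `πL` is constant on `[c̄ − ε, c̄]` and no scenario
consumption `x ω` lies in `(c̄ − ε, c̄]`. Then `C (c̄ − ε) < C c̄`; consequently,
such a capacity `c̄` is never an optimal booked capacity for the user. -/
theorem tlou_higher_breakpoint_never_optimal
    {Ω : Type*} [Fintype Ω]
    (x p : Ω → ℝ) (hx : ∀ ω, 0 ≤ x ω) (hp : ∀ ω, 0 < p ω)
    (K : ℝ) (hK : 0 < K)
    (πL πH : ℝ → ℝ) (hπHmono : Monotone πH)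
    (C : ℝ → ℝ)
    (hC : ∀ c : ℝ, C c = K * c
      + πL c * ∑ ω ∈ Finset.univ.filter (fun ω => x ω ≤ c), x ω * p ω
      + πH c * ∑ ω ∈ Finset.univ.filter (fun ω => c < x ω), x ω * p ω)
    (cbar ε : ℝ) (hcbar : 0 < cbar) (hε : 0 < ε) (hεc : ε ≤ cbar)
    (hπLconst : ∀ c : ℝ, cbar - ε ≤ c → c ≤ cbar → πL c = πL (cbar - ε))
    (hno : ∀ ω, ¬ (cbar - ε < x ω ∧ x ω ≤ cbar)) :
    C (cbar - ε) < C cbar ∧ ¬ (∀ c : ℝ, 0 ≤ c → C cbar ≤ C c) := by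
  have hiff : ∀ ω, x ω ≤ cbar ↔ x ω ≤ cbar - ε := fun ω =>
    ⟨fun h => not_lt.mp fun h' => hno ω ⟨h', h⟩, fun h => by linarith⟩
  have hiff' : ∀ ω, cbar < x ω ↔ cbar - ε < x ω := fun ω => by
    simpa only [not_le] using not_congr (hiff ω)
  have hlt : C (cbar - ε) < C cbar := by
    have hL : πL cbar = πL (cbar - ε) := hπLconst cbar (by linarith) le_rfl
    have hH : πH (cbar - ε) ≤ πH cbar := hπHmono (by linarith)
    have hnonneg : 0 ≤ ∑ ω ∈ Finset.univ.filter (fun ω => cbar - ε < x ω), x ω * p ω :=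
      Finset.sum_nonneg fun ω _ => mul_nonneg (hx ω) (hp ω).le
    have hK' : K * (cbar - ε) < K * cbar := mul_lt_mul_of_pos_left (by linarith) hK
    rw [hC, hC, hL]
    simp only [hiff, hiff']
    linarith [mul_le_mul_of_nonneg_right hH hnonneg]
  exact ⟨hlt, fun h => (h (cbar - ε) (by linarith)).not_gt hlt⟩
end

section
/- Let δ > 0 and let c_k ∈ S be a capacity candidate such that C(c_k) ≤ C(c_l) − δ for every c_l ∈ S with c_l ≠ c_k. Then c_k is the unique minimizer of C over the finite candidate set S, and moreover C(c_k) ≤ C(c) for every capacity c ≥ 0 (given booking fee K > 0, π^L a nonincreasing right-continuous step function with finite breakpoint set C^L, and π^H a nondecreasing right-continuous step function with finite breakpoint set C^H). -/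
/-- A finite set of reals containing `0` has a largest element below each nonnegative real. -/
theorem exists_greatest_le_of_zero_mem {S : Finset ℝ} (h0 : (0 : ℝ) ∈ S) {c : ℝ} (hc : 0 ≤ c) :
    ∃ a ∈ S, a ≤ c ∧ ∀ s ∈ S, s ≤ c → s ≤ a := by
  obtain ⟨a, ha, hmax⟩ := (S.filter (· ≤ c)).exists_max_image id
    ⟨0, Finset.mem_filter.2 ⟨h0, hc⟩⟩
  rw [Finset.mem_filter] at ha
  exact ⟨a, ha.1, ha.2, fun s hs hsc => hmax s (Finset.mem_filter.2 ⟨hs, hsc⟩)⟩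

/-- Let `δ > 0` and let `cₖ ∈ S` be a capacity candidate such that
`C cₖ ≤ C cₗ − δ` for every `cₗ ∈ S` with `cₗ ≠ cₖ`. Then `cₖ` is the unique
minimizer of `C` over the finite candidate set `S`, and moreover `C cₖ ≤ C c`
for every capacity `c ≥ 0`. -/
theorem tlou_strict_candidate_is_global_minimizer
    {Ω : Type*} [Fintype Ω]
    (x p : Ω → ℝ) (hx : ∀ ω, 0 ≤ x ω) (hp : ∀ ω, 0 < p ω)
    (K : ℝ) (hK : 0 < K)
    (πL πH : ℝ → ℝ) (CL CH : Finset ℝ)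
    (hCLpos : ∀ s ∈ CL, 0 < s) (hCHpos : ∀ s ∈ CH, 0 < s)
    (hπLanti : Antitone πL) (hπHmono : Monotone πH)
    (hπLstep : ∀ a b : ℝ, a ≤ b → (∀ s ∈ CL, ¬ (a < s ∧ s ≤ b)) → πL a = πL b)
    (hπHstep : ∀ a b : ℝ, a ≤ b → (∀ s ∈ CH, ¬ (a < s ∧ s ≤ b)) → πH a = πH b)
    (C : ℝ → ℝ)
    (hC : ∀ c : ℝ, C c = K * c
      + πL c * ∑ ω ∈ Finset.univ.filter (fun ω => x ω ≤ c), x ω * p ω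
      + πH c * ∑ ω ∈ Finset.univ.filter (fun ω => c < x ω), x ω * p ω)
    (δ : ℝ) (hδ : 0 < δ)
    (ck : ℝ) (hck : ck ∈ insert (0 : ℝ) (CL ∪ Finset.image x Finset.univ))
    (hopt : ∀ cl ∈ insert (0 : ℝ) (CL ∪ Finset.image x Finset.univ),
      cl ≠ ck → C ck ≤ C cl - δ) :
    (∀ cl ∈ insert (0 : ℝ) (CL ∪ Finset.image x Finset.univ), C ck ≤ C cl)
    ∧ (∀ cl ∈ insert (0 : ℝ) (CL ∪ Finset.image x Finset.univ),
        C cl ≤ C ck → cl = ck)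
    ∧ (∀ c : ℝ, 0 ≤ c → C ck ≤ C c) := by
  have hmin : ∀ cl ∈ insert (0 : ℝ) (CL ∪ Finset.image x Finset.univ), C ck ≤ C cl := by
    intro cl hcl
    rcases eq_or_ne cl ck with rfl | hne
    · exact le_rfl
    · linarith [hopt cl hcl hne]
  refine ⟨hmin, fun cl hcl hle => ?_, fun c hc => ?_⟩
  · by_contra hne
    linarith [hopt cl hcl hne]
  · obtain ⟨a, haS, hac, hmax⟩ := exists_greatest_le_of_zero_mem
      (Finset.mem_insert_self (0 : ℝ) (CL ∪ Finset.image x Finset.univ)) hc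
    refine (hmin a haS).trans ?_
    have hL : πL a = πL c := hπLstep a c hac fun s hs hsac =>
      hsac.1.not_ge (hmax s (by simp [hs]) hsac.2)
    have hle : ∀ ω, x ω ≤ a ↔ x ω ≤ c := fun ω =>
      ⟨fun h => h.trans hac, fun h => hmax (x ω) (by simp) h⟩
    have hlt : ∀ ω, a < x ω ↔ c < x ω := fun ω => by simpa using not_congr (hle ω)
    rw [hC a, hC c, hL]
    simp only [hle, hlt]
    have hsum : 0 ≤ ∑ ω ∈ Finset.univ.filter (fun ω => c < x ω), x ω * p ω :=
      Finset.sum_nonneg fun ω _ => mul_nonneg (hx ω) (hp ω).le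
    gcongr
    exact hπHmono hac
end
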